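/- Let {Vᵢ}ᵢ₌₁ⁿ be VLSMs over the same message set, each satisfying the channel authentication and sent-oracle assumptions, with a weight function from {1,…,n} to positive reals and a threshold t > 0. Let E ⊆ {1,…,n} with Σ_{i ∈ E} weight(i) < t. Then every valid trace of the fixed-set state-equivocation model V^E_{s_eqv} becomes, after replacing each regular component state s_i (i ∉ E) by the singleton list [s_i] and each label ⟨i, l⟩ with i ∉ E by ⟨i, ⟨1, l⟩⟩, a valid trace of the t-limited state-equivocation model V^{<t}_{s_eqv}. -/

import Mathlib

set_option autoImplicit false

universe u v w

/-- A validating labelled state transition and message production system (VLSM):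
labels, a nonempty set of initial states, initial messages, a total transition
function and a validity constraint.  `Option M` plays the role of `M ∪ {⊥}`. -/
structure VLSM (L : Type u) (S : Type v) (M : Type w) where
  init : Set S
  init_ne : init.Nonempty
  initMsg : Set M
  tau : L → S → Option M → S × Option M
  beta : L → S → Option M → Prop

/-- A transition record: label, source state, input message, target state, output message. -/
structure VTrans (L : Type u) (S : Type v) (M : Type w) where
  lbl : L
  src : S
  msg : Option M
  dst : S
  out : Option M

variable {L : Type u} {S : Type v} {M : Type w}

/-- `Chain s tr sf`: the transitions of `tr` link up, starting at `s` and ending at `sf`. -/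
def Chain : S → List (VTrans L S M) → S → Prop
  | s, [], sf => s = sf
  | s, t :: ts, sf => t.src = s ∧ Chain t.dst ts sf

namespace VLSM

/-- `t` is an actual transition of `V` (the transition function agrees with `t`). -/
def IsTrans (V : VLSM L S M) (t : VTrans L S M) : Prop :=
  V.tau t.lbl t.src t.msg = (t.dst, t.out)

/-- `t` is a constrained transition of `V`. -/
def IsConstrainedTrans (V : VLSM L S M) (t : VTrans L S M) : Prop :=
  V.IsTrans t ∧ V.beta t.lbl t.src t.msg

/-- `tr` is a constrained trace of `V` reaching the state `sf`. -/
def ConstrainedTraceTo (V : VLSM L S M) (tr : List (VTrans L S M)) (sf : S) : Prop :=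
  (∀ t ∈ tr, V.IsConstrainedTrans t) ∧ ∃ s0 ∈ V.init, Chain s0 tr sf

/-- A state is constrained if some constrained trace reaches it. -/
def ConstrainedState (V : VLSM L S M) (s : S) : Prop :=
  ∃ tr, V.ConstrainedTraceTo tr s

/-- Constrained reachability, defined inductively (a state is constrained iff it is
reachable from an initial state by constrained transitions). -/
inductive ReachState (V : VLSM L S M) : S → Prop where
  | init {s} : s ∈ V.init → ReachState V s
  | step {l s m} : ReachState V s → V.beta l s m → ReachState V (V.tau l s m).1

mutual
  /-- Valid states of a VLSM. -/
  inductive ValidState (V : VLSM L S M) : S → Prop where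
    | init {s} : s ∈ V.init → ValidState V s
    | step {l s m} : ValidState V s → ValidOMsg V m → V.beta l s m →
        ValidState V (V.tau l s m).1
  /-- Valid optional messages of a VLSM (`none` is always valid). -/
  inductive ValidOMsg (V : VLSM L S M) : Option M → Prop where
    | none : ValidOMsg V Option.none
    | init {m} : m ∈ V.initMsg → ValidOMsg V (some m)
    | step {l s m} : ValidState V s → ValidOMsg V m → V.beta l s m →
        ValidOMsg V (V.tau l s m).2
end

/-- `t` is a valid transition of `V`. -/
def IsValidTrans (V : VLSM L S M) (t : VTrans L S M) : Prop :=
  V.IsConstrainedTrans t ∧ V.ValidState t.src ∧ V.ValidOMsg t.msg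

/-- `tr` is a valid trace of `V` reaching the state `sf`. -/
def ValidTraceTo (V : VLSM L S M) (tr : List (VTrans L S M)) (sf : S) : Prop :=
  (∀ t ∈ tr, V.IsValidTrans t) ∧ ∃ s0 ∈ V.init, Chain s0 tr sf

/-- `tr` is a valid trace of `V`. -/
def IsValidTrace (V : VLSM L S M) (tr : List (VTrans L S M)) : Prop :=
  ∃ sf, V.ValidTraceTo tr sf

end VLSM

/-- The message `m` is emitted (sent) on the trace `tr`. -/
def EmittedOn (tr : List (VTrans L S M)) (m : M) : Prop := ∃ t ∈ tr, t.out = some m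

/-- The message `m` is received on the trace `tr`. -/
def ReceivedOn (tr : List (VTrans L S M)) (m : M) : Prop := ∃ t ∈ tr, t.msg = some m

/-- `sent` is a sent-oracle for `V`: at every constrained state `s`, `sent s m` holds
iff `m` is emitted on every constrained trace reaching `s`. -/
def IsSentOracle (V : VLSM L S M) (sent : S → M → Prop) : Prop :=
  ∀ s, V.ConstrainedState s → ∀ m,
    (sent s m ↔ ∀ tr, V.ConstrainedTraceTo tr s → EmittedOn tr m)

/-- `recv` is a received-oracle for `V`. -/
def IsReceivedOracle (V : VLSM L S M) (recv : S → M → Prop) : Prop :=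
  ∀ s, V.ConstrainedState s → ∀ m,
    (recv s m ↔ ∀ tr, V.ConstrainedTraceTo tr s → ReceivedOn tr m)

/-- The full node assumption: whenever receiving `m` is allowed by the validity
constraint, every direct dependency of `m` has been directly observed in the state. -/
def FullNodeAssumption (V : VLSM L S M) (dep : M → M → Prop)
    (sent recv : S → M → Prop) : Prop :=
  ∀ l s m, V.beta l s (some m) → ∀ m', dep m' m → sent s m' ∨ recv s m'

section Composition

variable {ι : Type*} [DecidableEq ι] {Lf : ι → Type*} {Sf : ι → Type*}

/-- The constrained composition of an indexed family of VLSMs over the same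
message set, under the composition constraint `φ`. -/
noncomputable def comp (V : ∀ i, VLSM (Lf i) (Sf i) M)
    (φ : (Σ i, Lf i) → (∀ i, Sf i) → Option M → Prop) :
    VLSM (Σ i, Lf i) (∀ i, Sf i) M where
  init := {σ | ∀ i, σ i ∈ (V i).init}
  init_ne := ⟨fun i => ((V i).init_ne).choose, fun i => ((V i).init_ne).choose_spec⟩
  initMsg := ⋃ i, (V i).initMsg
  tau := fun l σ m =>
    (Function.update σ l.1 ((V l.1).tau l.2 (σ l.1) m).1, ((V l.1).tau l.2 (σ l.1) m).2)
  beta := fun l σ m => (V l.1).beta l.2 (σ l.1) m ∧ φ l σ m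

/-- The free composition of an indexed family of VLSMs over the same message set. -/
noncomputable def freeComp (V : ∀ i, VLSM (Lf i) (Sf i) M) :
    VLSM (Σ i, Lf i) (∀ i, Sf i) M :=
  comp V fun _ _ _ => True

/-- Component `j` is a validator for the composite VLSM `W`: every constrained
transition from a constrained state of `V j` lifts to a valid transition of `W`
with matching `j`-th state components and matching input/output messages. -/
def IsValidatorAt (V : ∀ i, VLSM (Lf i) (Sf i) M)
    (W : VLSM (Σ i, Lf i) (∀ i, Sf i) M) (j : ι) : Prop :=
  ∀ l s m, (V j).ConstrainedState s → (V j).beta l s m →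
    ∃ σ : ∀ i, Sf i, σ j = s ∧
      W.IsValidTrans ⟨⟨j, l⟩, σ, m, (W.tau ⟨j, l⟩ σ m).1, (W.tau ⟨j, l⟩ σ m).2⟩ ∧
      (W.tau ⟨j, l⟩ σ m).1 j = ((V j).tau l s m).1 ∧
      (W.tau ⟨j, l⟩ σ m).2 = ((V j).tau l s m).2

/-- The induced `j`-th projection of a composite VLSM `W`: the same VLSM as the
component `Vj`, except that its initial messages are all valid messages of `W`. -/
def projV {L' : Type*} {S' : Type*} {L2 : Type*} {S2 : Type*}
    (Vj : VLSM L' S' M) (W : VLSM L2 S2 M) : VLSM L' S' M :=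
  { Vj with initMsg := {m | W.ValidOMsg (some m)} }

/-- The projection of a composite trace on component `j`. -/
def projTrace (j : ι) (tr : List (VTrans (Σ i, Lf i) (∀ i, Sf i) M)) :
    List (VTrans (Lf j) (Sf j) M) :=
  tr.filterMap fun t =>
    if h : t.lbl.1 = j then some ⟨h ▸ t.lbl.2, t.src j, t.msg, t.dst j, t.out⟩ else none

/-- The composition constraint of the fixed-set message-equivocation model:
the only message-equivocations allowed are among the components of `E`. -/
def phiM (sender : M → ι) (sent : ∀ i, Sf i → M → Prop) (E : Set ι) :
    (Σ i, Lf i) → (∀ i, Sf i) → Option M → Prop :=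
  fun l σ m => ∀ mm, m = some mm →
    (sent (sender mm) (σ (sender mm)) mm ∨ (l.1 ∈ E ∧ sender mm ∈ E))

end Composition

/-- Labels of the equivocating VLSM associated to a VLSM: act as the `i`-th copy,
duplicate the `i`-th copy, or spawn a new machine after position `i` (1-based). -/
inductive ELabel (L : Type u) (S : Type v) where
  | act (i : ℕ) (l : L)
  | dup (i : ℕ)
  | new (i : ℕ) (s : S)

/-- The equivocating VLSM associated to a VLSM `V`: its states are (nonempty) lists
of states of `V`, and it can fork itself or spawn fresh copies at any moment. -/
noncomputable def eVLSM (V : VLSM L S M) : VLSM (ELabel L S) (List S) M where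
  init := {γ | ∃ s ∈ V.init, γ = [s]}
  init_ne := ⟨[V.init_ne.choose], V.init_ne.choose, V.init_ne.choose_spec, rfl⟩
  initMsg := V.initMsg
  tau := fun lab γ m =>
    match lab with
    | .act i l =>
      match γ[i - 1]? with
      | some s => (γ.set (i - 1) (V.tau l s m).1, (V.tau l s m).2)
      | none => (γ, Option.none)
    | .dup i =>
      match γ[i - 1]? with
      | some s => (γ.take i ++ s :: γ.drop i, Option.none)
      | none => (γ, Option.none)
    | .new i s0 => (γ.take i ++ s0 :: γ.drop i, Option.none)
  beta := fun lab γ m =>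
    match lab with
    | .act i l => 1 ≤ i ∧ i ≤ γ.length ∧ ∃ s, γ[i - 1]? = some s ∧ V.beta l s m
    | .dup i => 1 ≤ i ∧ i ≤ γ.length ∧ m = Option.none
    | .new i s0 => 1 ≤ i ∧ i ≤ γ.length ∧ m = Option.none ∧ s0 ∈ V.init

section FixedSetEquivocation

variable {n : ℕ} {Lf Sf : Fin n → Type} {M : Type}

/-- State type of the `i`-th component in the fixed-set state-equivocation model:
the equivocating version (lists of states) for `i ∈ E`, the original state type
otherwise. -/
def mixS (E : Finset (Fin n)) (Sf : Fin n → Type) (i : Fin n) : Type :=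
  if i ∈ E then List (Sf i) else Sf i

/-- Label type of the `i`-th component in the fixed-set state-equivocation model. -/
def mixL (E : Finset (Fin n)) (Lf Sf : Fin n → Type) (i : Fin n) : Type :=
  if i ∈ E then ELabel (Lf i) (Sf i) else Lf i

def toListE (E : Finset (Fin n)) {i : Fin n} (h : i ∈ E) (x : mixS E Sf i) :
    List (Sf i) :=
  cast (by simp only [mixS, if_pos h]) x

def toPlainE (E : Finset (Fin n)) {i : Fin n} (h : i ∉ E) (x : mixS E Sf i) : Sf i :=
  cast (by simp only [mixS, if_neg h]) x

def toELbl (E : Finset (Fin n)) {i : Fin n} (h : i ∈ E) (l : mixL E Lf Sf i) :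
    ELabel (Lf i) (Sf i) :=
  cast (by simp only [mixL, if_pos h]) l

def toPlainLbl (E : Finset (Fin n)) {i : Fin n} (h : i ∉ E) (l : mixL E Lf Sf i) :
    Lf i :=
  cast (by simp only [mixL, if_neg h]) l

/-- The family of components of the fixed-set state-equivocation model: the
components of `E` are replaced by their equivocating versions. -/
noncomputable def mixV (E : Finset (Fin n)) (V : ∀ i, VLSM (Lf i) (Sf i) M)
    (i : Fin n) : VLSM (mixL E Lf Sf i) (mixS E Sf i) M := by
  unfold mixL mixS
  by_cases h : i ∈ E
  · simp only [if_pos h]; exact eVLSM (V i)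
  · simp only [if_neg h]; exact V i

/-- The sent oracle lifted to the components of the fixed-set state-equivocation
model (`sent^e` on equivocating components). -/
def sentMix (E : Finset (Fin n)) (sent : ∀ i, Sf i → M → Prop)
    (i : Fin n) (x : mixS E Sf i) (m : M) : Prop :=
  if h : i ∈ E then ∃ s ∈ toListE E h x, sent i s m
  else sent i (toPlainE E h x) m

/-- The composition constraint `φ_{s_eqv}` of the fixed-set state-equivocation model:
components may only receive messages sent in the current trace. -/
def phiS (E : Finset (Fin n)) (sender : M → Fin n) (sent : ∀ i, Sf i → M → Prop) :
    (Σ i, mixL E Lf Sf i) → (∀ i, mixS E Sf i) → Option M → Prop :=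
  fun _ γ m => ∀ mm, m = some mm → sentMix E sent (sender mm) (γ (sender mm)) mm

/-- The fixed-set state-equivocation model `V^E_{s_eqv}`. -/
noncomputable def VsE (E : Finset (Fin n)) (V : ∀ i, VLSM (Lf i) (Sf i) M)
    (sender : M → Fin n) (sent : ∀ i, Sf i → M → Prop) :
    VLSM (Σ i, mixL E Lf Sf i) (∀ i, mixS E Sf i) M :=
  comp (mixV E V) (phiS E sender sent)

/-- The state reduct of a state of the fixed-set state-equivocation model:
the first list entry for equivocating components. -/
noncomputable def reductS (E : Finset (Fin n)) (V : ∀ i, VLSM (Lf i) (Sf i) M)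
    (γ : ∀ i, mixS E Sf i) : ∀ i, Sf i :=
  fun i =>
    if h : i ∈ E then (toListE E h (γ i)).headD (V i).init_ne.choose
    else toPlainE E h (γ i)

/-- The transition reduct: transitions on the first copy of an equivocating
component (or on a non-equivocating component) reduce to transitions of the
composition of the original components; all others are dropped. -/
noncomputable def transReduct (E : Finset (Fin n)) (V : ∀ i, VLSM (Lf i) (Sf i) M)
    (t : VTrans (Σ i, mixL E Lf Sf i) (∀ i, mixS E Sf i) M) :
    Option (VTrans (Σ i, Lf i) (∀ i, Sf i) M) :=
  if h : t.lbl.1 ∈ E then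
    match toELbl E h t.lbl.2 with
    | .act 1 l => some ⟨⟨t.lbl.1, l⟩, reductS E V t.src, t.msg, reductS E V t.dst, t.out⟩
    | _ => none
  else
    some ⟨⟨t.lbl.1, toPlainLbl E h t.lbl.2⟩,
      reductS E V t.src, t.msg, reductS E V t.dst, t.out⟩

/-- The trace reduct of a trace of the fixed-set state-equivocation model. -/
noncomputable def traceReduct (E : Finset (Fin n)) (V : ∀ i, VLSM (Lf i) (Sf i) M)
    (tr : List (VTrans (Σ i, mixL E Lf Sf i) (∀ i, mixS E Sf i) M)) :
    List (VTrans (Σ i, Lf i) (∀ i, Sf i) M) :=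
  tr.filterMap (transReduct E V)

/-- The fixed-set message-equivocation model `V^E_{m_eqv}`. -/
noncomputable def VmE (E : Finset (Fin n)) (V : ∀ i, VLSM (Lf i) (Sf i) M)
    (sender : M → Fin n) (sent : ∀ i, Sf i → M → Prop) :
    VLSM (Σ i, Lf i) (∀ i, Sf i) M :=
  comp V (phiM sender sent ↑E)

end FixedSetEquivocation

section LimitedEquivocation

variable {n : ℕ} {Lf Sf : Fin n → Type} {M : Type}

/-- The composition constraint `φ^{<t}_{s_eqv}` of the t-limited state-equivocation
model: messages must have been sent in the current trace, and the total weight of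
the components whose list of copies has more than one entry after the transition
stays below the threshold. -/
noncomputable def phiSlim (V : ∀ i, VLSM (Lf i) (Sf i) M) (sender : M → Fin n)
    (sent : ∀ i, Sf i → M → Prop) (w : Fin n → ℝ) (t : ℝ) :
    (Σ i, ELabel (Lf i) (Sf i)) → (∀ i, List (Sf i)) → Option M → Prop :=
  fun l γ m =>
    (∀ mm, m = some mm → ∃ s ∈ γ (sender mm), sent (sender mm) s mm) ∧
    (∑ k ∈ Finset.univ.filter fun k : Fin n =>
        1 < (Function.update γ l.1 ((eVLSM (V l.1)).tau l.2 (γ l.1) m).1 k).length,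
      w k) < t

/-- The t-limited state-equivocation model `V^{<t}_{s_eqv}`: every component is
replaced by its equivocating version. -/
noncomputable def Vslim (V : ∀ i, VLSM (Lf i) (Sf i) M) (sender : M → Fin n)
    (sent : ∀ i, Sf i → M → Prop) (w : Fin n → ℝ) (t : ℝ) :
    VLSM (Σ i, ELabel (Lf i) (Sf i)) (∀ i, List (Sf i)) M :=
  comp (fun i => eVLSM (V i)) (phiSlim V sender sent w t)

/-- The state reduct for the t-limited state-equivocation model: the first list
entry of each component. -/
noncomputable def reductLim (V : ∀ i, VLSM (Lf i) (Sf i) M)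
    (γ : ∀ i, List (Sf i)) : ∀ i, Sf i :=
  fun i => (γ i).headD (V i).init_ne.choose

/-- The transition reduct for the t-limited state-equivocation model. -/
noncomputable def transReductLim (V : ∀ i, VLSM (Lf i) (Sf i) M)
    (t : VTrans (Σ i, ELabel (Lf i) (Sf i)) (∀ i, List (Sf i)) M) :
    Option (VTrans (Σ i, Lf i) (∀ i, Sf i) M) :=
  match t.lbl.2 with
  | .act 1 l => some ⟨⟨t.lbl.1, l⟩, reductLim V t.src, t.msg, reductLim V t.dst, t.out⟩
  | _ => none

/-- The trace reduct for the t-limited state-equivocation model. -/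
noncomputable def traceReductLim (V : ∀ i, VLSM (Lf i) (Sf i) M)
    (tr : List (VTrans (Σ i, ELabel (Lf i) (Sf i)) (∀ i, List (Sf i)) M)) :
    List (VTrans (Σ i, Lf i) (∀ i, Sf i) M) :=
  tr.filterMap (transReductLim V)

open scoped Classical in
/-- Updating the set of equivocators on a transition: the sender of the received
message is added if the message has not been sent in the current composite state. -/
noncomputable def updEqv (sender : M → Fin n) (sent : ∀ i, Sf i → M → Prop)
    (σ : ∀ i, Sf i) (m : Option M) (eqv : Finset (Fin n)) : Finset (Fin n) :=
  match m with
  | Option.none => eqv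
  | some mm => if ∃ i, sent i (σ i) mm then eqv else insert (sender mm) eqv

/-- The t-limited message-equivocation model `V^{<t}_{m_eqv}`: the free composition
annotated with the set of equivocators observed in the current trace, constrained
so that the total weight of equivocators stays below the threshold. -/
noncomputable def annV (V : ∀ i, VLSM (Lf i) (Sf i) M) (sender : M → Fin n)
    (sent : ∀ i, Sf i → M → Prop) (w : Fin n → ℝ) (t : ℝ) :
    VLSM (Σ i, Lf i) ((∀ i, Sf i) × Finset (Fin n)) M where
  init := {p | (∀ i, p.1 i ∈ (V i).init) ∧ p.2 = ∅}
  init_ne :=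
    ⟨⟨fun i => ((V i).init_ne).choose, ∅⟩, fun i => ((V i).init_ne).choose_spec, rfl⟩
  initMsg := ⋃ i, (V i).initMsg
  tau := fun l p m =>
    ((Function.update p.1 l.1 ((V l.1).tau l.2 (p.1 l.1) m).1,
      updEqv sender sent p.1 m p.2),
     ((V l.1).tau l.2 (p.1 l.1) m).2)
  beta := fun l p m =>
    (V l.1).beta l.2 (p.1 l.1) m ∧
      (∑ j ∈ updEqv sender sent p.1 m p.2, w j) < t

/-- Annotating a trace of the free composition with the accumulated sets of
equivocators, starting from the given set. -/
noncomputable def annotate (sender : M → Fin n) (sent : ∀ i, Sf i → M → Prop) :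
    Finset (Fin n) → List (VTrans (Σ i, Lf i) (∀ i, Sf i) M) →
      List (VTrans (Σ i, Lf i) ((∀ i, Sf i) × Finset (Fin n)) M)
  | _, [] => []
  | eqv, t :: ts =>
      ⟨t.lbl, (t.src, eqv), t.msg, (t.dst, updEqv sender sent t.src t.msg eqv), t.out⟩ ::
        annotate sender sent (updEqv sender sent t.src t.msg eqv) ts

/-- Forgetting the equivocator annotations of a transition. -/
def stripAnn (t : VTrans (Σ i, Lf i) ((∀ i, Sf i) × Finset (Fin n)) M) :
    VTrans (Σ i, Lf i) (∀ i, Sf i) M :=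
  ⟨t.lbl, t.src.1, t.msg, t.dst.1, t.out⟩

end LimitedEquivocation

section Embedding

variable {n : ℕ} {Lf Sf : Fin n → Type} {M : Type}

/-- Embedding the states of the fixed-set state-equivocation model into the
all-equivocator states: regular component states become singleton lists. -/
noncomputable def embedS (E : Finset (Fin n)) (γ : ∀ i, mixS E Sf i) :
    ∀ i, List (Sf i) :=
  fun i => if h : i ∈ E then toListE E h (γ i) else [toPlainE E h (γ i)]

/-- Embedding the labels of the fixed-set state-equivocation model: labels of
regular components act on the first (unique) copy. -/
noncomputable def embedL (E : Finset (Fin n)) (l : Σ i, mixL E Lf Sf i) :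
    Σ i, ELabel (Lf i) (Sf i) :=
  if h : l.1 ∈ E then ⟨l.1, toELbl E h l.2⟩
  else ⟨l.1, .act 1 (toPlainLbl E h l.2)⟩

/-- Embedding transitions of the fixed-set state-equivocation model into the
t-limited state-equivocation model. -/
noncomputable def embedT (E : Finset (Fin n))
    (t : VTrans (Σ i, mixL E Lf Sf i) (∀ i, mixS E Sf i) M) :
    VTrans (Σ i, ELabel (Lf i) (Sf i)) (∀ i, List (Sf i)) M :=
  ⟨embedL E t.lbl, embedS E t.src, t.msg, embedS E t.dst, t.out⟩

/-- Mapping all-equivocator states back to states of the fixed-set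
state-equivocation model: components outside `E` are replaced by their unique
(first) entry. -/
noncomputable def unembedS (E : Finset (Fin n)) (V : ∀ i, VLSM (Lf i) (Sf i) M)
    (γ : ∀ i, List (Sf i)) : ∀ i, mixS E Sf i :=
  fun i =>
    if h : i ∈ E then
      cast (show List (Sf i) = mixS E Sf i by simp only [mixS, if_pos h]) (γ i)
    else
      cast (show Sf i = mixS E Sf i by simp only [mixS, if_neg h])
        ((γ i).headD (V i).init_ne.choose)

/-- Mapping all-equivocator labels back to labels of the fixed-set
state-equivocation model: labels `⟨i, ⟨1, l⟩⟩` with `i ∉ E` become `⟨i, l⟩`. -/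
noncomputable def unembedL (E : Finset (Fin n)) (l : Σ i, ELabel (Lf i) (Sf i)) :
    Option (Σ i, mixL E Lf Sf i) :=
  if h : l.1 ∈ E then
    some ⟨l.1,
      cast (show ELabel (Lf l.1) (Sf l.1) = mixL E Lf Sf l.1 by
        simp only [mixL, if_pos h]) l.2⟩
  else
    match l.2 with
    | .act 1 ll =>
        some ⟨l.1,
          cast (show Lf l.1 = mixL E Lf Sf l.1 by simp only [mixL, if_neg h]) ll⟩
    | _ => none

/-- Mapping all-equivocator transitions back to transitions of the fixed-set
state-equivocation model. -/
noncomputable def unembedT (E : Finset (Fin n)) (V : ∀ i, VLSM (Lf i) (Sf i) M)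
    (t : VTrans (Σ i, ELabel (Lf i) (Sf i)) (∀ i, List (Sf i)) M) :
    Option (VTrans (Σ i, mixL E Lf Sf i) (∀ i, mixS E Sf i) M) :=
  (unembedL E t.lbl).map fun l =>
    ⟨l, unembedS E V t.src, t.msg, unembedS E V t.dst, t.out⟩

end Embedding

namespace VLSM

section Simulation

variable {L₁ : Type*} {S₁ : Type*} {L₂ : Type*} {S₂ : Type*} {N : Type*}

/-- A pair of maps on labels and states that carries one VLSM into another,
preserving messages. -/
structure IsSimulation (A : VLSM L₁ S₁ N) (B : VLSM L₂ S₂ N) (g : L₁ → L₂) (f : S₁ → S₂) :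
    Prop where
  init : ∀ s ∈ A.init, f s ∈ B.init
  initMsg : A.initMsg ⊆ B.initMsg
  tau : ∀ l s m, B.tau (g l) (f s) m = (f (A.tau l s m).1, (A.tau l s m).2)
  beta : ∀ l s m, A.beta l s m → B.beta (g l) (f s) m

variable {A : VLSM L₁ S₁ N} {B : VLSM L₂ S₂ N} {g : L₁ → L₂} {f : S₁ → S₂}

mutual

theorem IsSimulation.validState (H : IsSimulation A B g f) {s : S₁} :
    A.ValidState s → B.ValidState (f s)
  | .init hs => .init (H.init _ hs)
  | .step (l := l) (s := s) (m := m) hs hm hb => by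
    have h := ValidState.step (H.validState hs) (H.validOMsg hm) (H.beta _ _ _ hb)
    rwa [H.tau l s m] at h

theorem IsSimulation.validOMsg (H : IsSimulation A B g f) {m : Option N} :
    A.ValidOMsg m → B.ValidOMsg m
  | .none => .none
  | .init hm => .init (H.initMsg hm)
  | .step (l := l) (s := s) (m := m) hs hm hb => by
    have h := ValidOMsg.step (H.validState hs) (H.validOMsg hm) (H.beta _ _ _ hb)
    rwa [H.tau l s m] at h

end

theorem IsSimulation.isValidTrans (H : IsSimulation A B g f) {t : VTrans L₁ S₁ N}
    (ht : A.IsValidTrans t) :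
    B.IsValidTrans ⟨g t.lbl, f t.src, t.msg, f t.dst, t.out⟩ := by
  obtain ⟨⟨htau, hbeta⟩, hsrc, hmsg⟩ := ht
  refine ⟨⟨?_, H.beta _ _ _ hbeta⟩, H.validState hsrc, H.validOMsg hmsg⟩
  unfold IsTrans at htau ⊢
  simp [H.tau, htau]

end Simulation

end VLSM

theorem Chain.map {L₁ S₁ L₂ S₂ N : Type*} (g : L₁ → L₂) (f : S₁ → S₂) :
    ∀ {s : S₁} {tr : List (VTrans L₁ S₁ N)} {sf : S₁}, Chain s tr sf →
      Chain (f s) (tr.map fun t => ⟨g t.lbl, f t.src, t.msg, f t.dst, t.out⟩) (f sf)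
  | _, [], _, h => congrArg f h
  | _, _ :: _, _, h => ⟨congrArg f h.1, h.2.map g f⟩

theorem VLSM.IsSimulation.isValidTrace {L₁ S₁ L₂ S₂ N : Type*} {A : VLSM L₁ S₁ N}
    {B : VLSM L₂ S₂ N} {g : L₁ → L₂} {f : S₁ → S₂} (H : IsSimulation A B g f)
    {tr : List (VTrans L₁ S₁ N)} (h : A.IsValidTrace tr) :
    B.IsValidTrace (tr.map fun t => ⟨g t.lbl, f t.src, t.msg, f t.dst, t.out⟩) := by
  obtain ⟨sf, htr, s₀, hs₀, hc⟩ := h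
  refine ⟨f sf, fun t' ht' => ?_, f s₀, H.init _ hs₀, hc.map g f⟩
  obtain ⟨t, ht, rfl⟩ := List.mem_map.1 ht'
  exact H.isValidTrans (htr t ht)

/-- Casting along equalities of the label and state types is a simulation. -/
theorem VLSM.isSimulation_cast {L₁ L₂ : Type u} {S₁ S₂ : Type v} {N : Type w}
    (hL : L₁ = L₂) (hS : S₁ = S₂) {A : VLSM L₁ S₁ N} {B : VLSM L₂ S₂ N} (h : A ≍ B) :
    IsSimulation A B (cast hL) (cast hS) := by
  subst hL hS
  obtain rfl := eq_of_heq h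
  exact ⟨fun _ h => h, subset_rfl, fun _ _ _ => rfl, fun _ _ _ h => h⟩

/-- A VLSM is simulated by the first copy of its equivocating version. -/
theorem VLSM.isSimulation_eVLSM {L S M : Type*} (V : VLSM L S M) :
    IsSimulation V (eVLSM V) (.act 1) (fun s => [s]) where
  init s hs := ⟨s, hs, rfl⟩
  initMsg := subset_rfl
  tau _ _ _ := rfl
  beta _ s _ h := ⟨le_rfl, le_rfl, s, rfl, h⟩

section MixedFamily

variable {n : ℕ} {Lf Sf : Fin n → Type} {M : Type}

theorem mixV_heq_eVLSM (E : Finset (Fin n)) (V : ∀ i, VLSM (Lf i) (Sf i) M) {i : Fin n}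
    (h : i ∈ E) : mixV E V i ≍ eVLSM (V i) := by
  unfold mixV
  simp only [h, id, eq_mpr_eq_cast, dite_true]
  exact cast_heq _ _

theorem mixV_heq (E : Finset (Fin n)) (V : ∀ i, VLSM (Lf i) (Sf i) M) {i : Fin n}
    (h : i ∉ E) : mixV E V i ≍ V i := by
  unfold mixV
  simp only [h, id, eq_mpr_eq_cast, dite_false]
  exact cast_heq _ _

/-- The component at `i` of `embedS`. -/
noncomputable def embedSAt (E : Finset (Fin n)) (i : Fin n) (x : mixS E Sf i) : List (Sf i) :=
  if h : i ∈ E then toListE E h x else [toPlainE E h x]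

/-- The component at `i` of `embedL`. -/
noncomputable def embedLAt (E : Finset (Fin n)) (i : Fin n) (l : mixL E Lf Sf i) :
    ELabel (Lf i) (Sf i) :=
  if h : i ∈ E then toELbl E h l else .act 1 (toPlainLbl E h l)

theorem embedL_eq (E : Finset (Fin n)) (l : Σ i, mixL E Lf Sf i) :
    embedL E l = ⟨l.1, embedLAt E l.1 l.2⟩ := by
  unfold embedL embedLAt
  split <;> rfl

theorem mixV_isSimulation (E : Finset (Fin n)) (V : ∀ i, VLSM (Lf i) (Sf i) M) (i : Fin n) :
    VLSM.IsSimulation (mixV E V i) (eVLSM (V i)) (embedLAt E i) (embedSAt E i) := by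
  by_cases h : i ∈ E
  · have H := VLSM.isSimulation_cast (by simp only [mixL, if_pos h])
      (by simp only [mixS, if_pos h]) (mixV_heq_eVLSM E V h)
    convert H using 1 <;> ext x : 1
    · exact dif_pos h
    · exact dif_pos h
  · have H := VLSM.isSimulation_cast (by simp only [mixL, if_neg h])
      (by simp only [mixS, if_neg h]) (mixV_heq E V h)
    have K := (V i).isSimulation_eVLSM
    have hL : embedLAt E i = fun l : mixL E Lf Sf i => .act 1 (toPlainLbl E h l) :=
      funext fun _ => dif_neg h
    have hS : embedSAt E i = fun x : mixS E Sf i => [toPlainE E h x] :=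
      funext fun _ => dif_neg h
    rw [hL, hS]
    exact ⟨fun s hs => K.init _ (H.init s hs), H.initMsg.trans K.initMsg,
      fun l s m => (K.tau _ _ m).trans (congrArg (fun p => ([p.1], p.2)) (H.tau l s m)),
      fun l s m hb => K.beta _ _ _ (H.beta l s m hb)⟩

theorem embedS_length_of_notMem {E : Finset (Fin n)} (γ : ∀ i, mixS E Sf i) {i : Fin n}
    (h : i ∉ E) : (embedS E γ i).length = 1 := by
  simp [embedS, h]

theorem sentMix_iff (E : Finset (Fin n)) (sent : ∀ i, Sf i → M → Prop)
    (γ : ∀ i, mixS E Sf i) (i : Fin n) (m : M) :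
    sentMix E sent i (γ i) m ↔ ∃ s ∈ embedS E γ i, sent i s m := by
  by_cases h : i ∈ E <;> simp [sentMix, embedS, h]

theorem Vslim_tau_embed (V : ∀ i, VLSM (Lf i) (Sf i) M) (sender : M → Fin n)
    (sent : ∀ i, Sf i → M → Prop) (w : Fin n → ℝ) (t : ℝ) (E : Finset (Fin n))
    (l : Σ i, mixL E Lf Sf i) (γ : ∀ i, mixS E Sf i) (m : Option M) :
    (Vslim V sender sent w t).tau (embedL E l) (embedS E γ) m =
      (embedS E ((VsE E V sender sent).tau l γ m).1,
        ((VsE E V sender sent).tau l γ m).2) := by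
  have H := (mixV_isSimulation E V l.1).tau l.2 (γ l.1) m
  rw [embedL_eq]
  change (Function.update (embedS E γ) l.1
    ((eVLSM (V l.1)).tau (embedLAt E l.1 l.2) (embedSAt E l.1 (γ l.1)) m).1,
    ((eVLSM (V l.1)).tau (embedLAt E l.1 l.2) (embedSAt E l.1 (γ l.1)) m).2) = _
  rw [H]
  refine Prod.ext ?_ rfl
  funext k
  change _ = embedSAt E k (Function.update γ l.1 _ k)
  rw [Function.apply_update (embedSAt E)]
  rfl

theorem VsE_isSimulation_Vslim (V : ∀ i, VLSM (Lf i) (Sf i) M) (sender : M → Fin n)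
    (sent : ∀ i, Sf i → M → Prop) {w : Fin n → ℝ} (hw : ∀ i, 0 ≤ w i) {t : ℝ}
    {E : Finset (Fin n)} (hE : (∑ i ∈ E, w i) < t) :
    VLSM.IsSimulation (VsE E V sender sent) (Vslim V sender sent w t)
      (embedL E) (embedS E) where
  init γ hγ i := (mixV_isSimulation E V i).init _ (hγ i)
  initMsg := Set.iUnion_mono fun i => (mixV_isSimulation E V i).initMsg
  tau := Vslim_tau_embed V sender sent w t E
  beta l γ m hb := by
    have hout := congrArg Prod.fst (Vslim_tau_embed V sender sent w t E l γ m)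
    refine ⟨?_, fun mm hmm => (sentMix_iff E sent γ _ mm).1 (hb.2 mm hmm), ?_⟩
    · rw [embedL_eq]
      exact (mixV_isSimulation E V l.1).beta _ _ _ hb.1
    · refine lt_of_le_of_lt
        (Finset.sum_le_sum_of_subset_of_nonneg (fun k hk => ?_) fun i _ _ => hw i) hE
      by_contra hkE
      have hlen : 1 < (((Vslim V sender sent w t).tau (embedL E l) (embedS E γ) m).1 k).length :=
        (Finset.mem_filter.1 hk).2
      rw [hout, embedS_length_of_notMem _ hkE] at hlen
      exact lt_irrefl _ hlen

end MixedFamily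

/-- If the weight of the fixed set `E` of equivocators is below the threshold, then
every valid trace of the fixed-set state-equivocation model embeds (replacing
regular component states `s` by `[s]` and regular labels `l` by `⟨1, l⟩`) into a
valid trace of the t-limited state-equivocation model. -/
theorem equivocators_Fixed_incl_Limited
    {n : ℕ} {Lf Sf : Fin n → Type} {M : Type}
    (V : ∀ i, VLSM (Lf i) (Sf i) M) (sender : M → Fin n)
    (sent : ∀ i, Sf i → M → Prop) (hsent : ∀ i, IsSentOracle (V i) (sent i))
    (w : Fin n → ℝ) (hw : ∀ i, 0 < w i) (t : ℝ) (ht : 0 < t)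
    (E : Finset (Fin n)) (hE : (∑ i ∈ E, w i) < t)
    (tr : List (VTrans (Σ i, mixL E Lf Sf i) (∀ i, mixS E Sf i) M))
    (h : (VsE E V sender sent).IsValidTrace tr) :
    (Vslim V sender sent w t).IsValidTrace (tr.map (embedT E)) := by
  exact (VsE_isSimulation_Vslim V sender sent (fun i => (hw i).le) hE).isValidTrace h
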